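/- arXiv:1301.3411 — 7 statements merged into one kernel-verified Lean document; each statement's English description precedes it below -/
import Mathlib

section
/- Let G be a nontrivial finite group that is a quotient of the (2,3,7)-triangle group Δ = ⟨x, y | x² = y³ = (xy)⁷ = 1⟩ (i.e., there is a surjective group homomorphism Δ → G). Then 42 divides the order of G; in particular |G| ≥ 42. -/
/-- The relations of the (2,3,7)-triangle group: `x²`, `y³`, `(xy)⁷` in the free
group on two generators `x = FreeGroup.of 0`, `y = FreeGroup.of 1`. -/
def triangleRels : Set (FreeGroup (Fin 2)) :=
  {(FreeGroup.of 0) ^ 2, (FreeGroup.of 1) ^ 3, (FreeGroup.of 0 * FreeGroup.of 1) ^ 7}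

/-- The (2,3,7)-triangle group `Δ = ⟨x, y | x² = y³ = (xy)⁷ = 1⟩`. -/
abbrev TriangleGroup : Type := PresentedGroup triangleRels

/-- An element killed by two coprime exponents is trivial. -/
theorem eq_one_of_pow_eq_one_of_coprime {G : Type*} [Group G] {g : G} {m n : ℕ}
    (hmn : m.Coprime n) (hm : g ^ m = 1) (hn : g ^ n = 1) : g = 1 := by
  simpa [hmn.gcd_eq_one] using pow_gcd_eq_one.mpr ⟨hm, hn⟩

/-- A homomorphism from the triangle group that kills both generators is trivial. -/
theorem TriangleGroup.hom_eq_one {G : Type*} [Group G] {π : TriangleGroup →* G}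
    (hx : π (PresentedGroup.of 0) = 1) (hy : π (PresentedGroup.of 1) = 1) : π = 1 := by
  refine PresentedGroup.ext fun i => ?_
  fin_cases i
  · exact hx
  · exact hy

theorem TriangleGroup.of_zero_pow_two : (PresentedGroup.of 0 : TriangleGroup) ^ 2 = 1 :=
  PresentedGroup.one_of_mem (rels := triangleRels) (by simp [triangleRels])

theorem TriangleGroup.of_one_pow_three : (PresentedGroup.of 1 : TriangleGroup) ^ 3 = 1 :=
  PresentedGroup.one_of_mem (rels := triangleRels) (by simp [triangleRels])

theorem TriangleGroup.of_zero_mul_of_one_pow_seven :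
    (PresentedGroup.of 0 * PresentedGroup.of 1 : TriangleGroup) ^ 7 = 1 :=
  PresentedGroup.one_of_mem (rels := triangleRels) (by simp [triangleRels])

theorem stmt_4 (G : Type) [Group G] [Finite G] [Nontrivial G]
    (π : TriangleGroup →* G) (hπ : Function.Surjective π) :
    42 ∣ Nat.card G ∧ 42 ≤ Nat.card G := by
  obtain ⟨a, ha⟩ : ∃ a, π (PresentedGroup.of 0) = a := ⟨_, rfl⟩
  obtain ⟨b, hb⟩ : ∃ b, π (PresentedGroup.of 1) = b := ⟨_, rfl⟩
  have ha2 : a ^ 2 = 1 := by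
    rw [← ha, ← map_pow, TriangleGroup.of_zero_pow_two, map_one]
  have hb3 : b ^ 3 = 1 := by
    rw [← hb, ← map_pow, TriangleGroup.of_one_pow_three, map_one]
  have hab7 : (a * b) ^ 7 = 1 := by
    rw [← ha, ← hb, ← map_mul, ← map_pow, TriangleGroup.of_zero_mul_of_one_pow_seven, map_one]
  have not_both : ¬ (a = 1 ∧ b = 1) := by
    rintro ⟨rfl, rfl⟩
    obtain ⟨g, hg⟩ := exists_ne (1 : G)
    obtain ⟨t, rfl⟩ := hπ g
    exact hg (by rw [TriangleGroup.hom_eq_one ha hb, MonoidHom.one_apply])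
  have ha1 : a ≠ 1 := fun h => not_both
    ⟨h, eq_one_of_pow_eq_one_of_coprime (n := 7) (by norm_num) hb3 (by simpa [h] using hab7)⟩
  have hb1 : b ≠ 1 := fun h => not_both
    ⟨eq_one_of_pow_eq_one_of_coprime (n := 7) (by norm_num) ha2 (by simpa [h] using hab7), h⟩
  have hab1 : a * b ≠ 1 := fun h => hb1 <|
    eq_one_of_pow_eq_one_of_coprime (m := 2) (n := 3) (by norm_num)
      (by rw [eq_inv_of_mul_eq_one_right h, inv_pow, ha2, inv_one]) hb3
  have : Fact (Nat.Prime 7) := ⟨by norm_num⟩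
  have h2 : 2 ∣ Nat.card G := orderOf_eq_prime ha2 ha1 ▸ orderOf_dvd_natCard a
  have h3 : 3 ∣ Nat.card G := orderOf_eq_prime hb3 hb1 ▸ orderOf_dvd_natCard b
  have h7 : 7 ∣ Nat.card G := orderOf_eq_prime hab7 hab1 ▸ orderOf_dvd_natCard (a * b)
  have h42 : 42 ∣ Nat.card G := by omega
  exact ⟨h42, Nat.le_of_dvd Nat.card_pos h42⟩
end

section
/- Let G be a nontrivial finite group that is a quotient of the (2,3,7)-triangle group Δ = ⟨x, y | x² = y³ = (xy)⁷ = 1⟩. Then |G| ≥ 6 and there exists a surjective group homomorphism from the free product (ℤ/2ℤ) ∗ (ℤ/3ℤ) onto G. -/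
/-- The modular group `Γ = ⟨x, y | x² = y³ = 1⟩`, realized as the free product
`(ℤ/2ℤ) ∗ (ℤ/3ℤ)`. -/
abbrev ModularGroup' : Type :=
  Monoid.Coprod (Multiplicative (ZMod 2)) (Multiplicative (ZMod 3))

/-- The homomorphism from the multiplicative cyclic group of order `n` sending the generator
to an element `g` with `g ^ n = 1`. -/
def zmodPowersHom {G : Type*} [Group G] (n : ℕ) (g : G) (hg : g ^ n = 1) :
    Multiplicative (ZMod n) →* G :=
  AddMonoidHom.toMultiplicativeLeft
    (ZMod.lift n ⟨zmultiplesHom (Additive G) (Additive.ofMul g), by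
      simp [← ofMul_pow, hg]⟩)

theorem zmodPowersHom_ofAdd_one {G : Type*} [Group G] (n : ℕ) (g : G) (hg : g ^ n = 1) :
    zmodPowersHom n g hg (Multiplicative.ofAdd 1) = g := by
  have h := ZMod.lift_coe n (A := Additive G)
    ⟨zmultiplesHom (Additive G) (Additive.ofMul g), by simp [← ofMul_pow, hg]⟩ 1
  simp only [Int.cast_one, zmultiplesHom_apply, one_smul] at h
  exact congrArg Additive.toMul h

/-- Two elements of orders dividing `2` and `3` that generate `G` exhibit `G` as a quotient
of the modular group. -/
theorem exists_surjective_modularGroup {G : Type*} [Group G] {a b : G} (ha : a ^ 2 = 1)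
    (hb : b ^ 3 = 1) (hgen : Subgroup.closure {a, b} = ⊤) :
    ∃ f : ModularGroup' →* G, Function.Surjective f := by
  refine ⟨Monoid.Coprod.lift (zmodPowersHom 2 a ha) (zmodPowersHom 3 b hb), ?_⟩
  rw [← MonoidHom.range_eq_top, eq_top_iff, ← hgen, Subgroup.closure_le]
  rintro g (rfl | rfl)
  · exact ⟨Monoid.Coprod.inl (Multiplicative.ofAdd 1), by
      rw [Monoid.Coprod.lift_apply_inl, zmodPowersHom_ofAdd_one]⟩
  · exact ⟨Monoid.Coprod.inr (Multiplicative.ofAdd 1), by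
      rw [Monoid.Coprod.lift_apply_inr, zmodPowersHom_ofAdd_one]⟩

/-- A nontrivial finite group generated by `a`, `b` with `a² = b³ = (ab)⁷ = 1` has order
at least `6`. -/
theorem six_le_card_of_triangle_relations {G : Type*} [Group G] [Finite G] [Nontrivial G]
    {a b : G} (ha : a ^ 2 = 1) (hb : b ^ 3 = 1) (hab : (a * b) ^ 7 = 1)
    (hgen : Subgroup.closure {a, b} = ⊤) : 6 ≤ Nat.card G := by
  have hne : ¬ (a = 1 ∧ b = 1) := by
    rintro ⟨rfl, rfl⟩
    simp only [Set.pair_eq_singleton, Subgroup.closure_singleton_one] at hgen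
    exact bot_ne_top hgen
  have ha1 : a ≠ 1 := by
    rintro rfl
    rw [one_mul] at hab
    exact hne ⟨rfl, eq_one_of_pow_eq_one_of_coprime (by norm_num) hb hab⟩
  have hb1 : b ≠ 1 := by
    rintro rfl
    rw [mul_one] at hab
    exact hne ⟨eq_one_of_pow_eq_one_of_coprime (by norm_num) ha hab, rfl⟩
  have h2 : 2 ∣ Nat.card G := orderOf_eq_prime ha ha1 ▸ orderOf_dvd_natCard a
  have h3 : 3 ∣ Nat.card G := orderOf_eq_prime hb hb1 ▸ orderOf_dvd_natCard b
  have hpos : 0 < Nat.card G := Nat.card_pos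
  lia

theorem stmt_5 (G : Type) [Group G] [Finite G] [Nontrivial G]
    (π : TriangleGroup →* G) (hπ : Function.Surjective π) :
    6 ≤ Nat.card G ∧ ∃ π' : ModularGroup' →* G, Function.Surjective π' := by
  let x : TriangleGroup := PresentedGroup.of 0
  let y : TriangleGroup := PresentedGroup.of 1
  have hx : x ^ 2 = 1 := PresentedGroup.one_of_mem (rels := triangleRels) (.inl rfl)
  have hy : y ^ 3 = 1 := PresentedGroup.one_of_mem (rels := triangleRels) (.inr (.inl rfl))
  have hxy : (x * y) ^ 7 = 1 :=
    PresentedGroup.one_of_mem (rels := triangleRels) (.inr (.inr rfl))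
  have ha : π x ^ 2 = 1 := by rw [← map_pow, hx, map_one]
  have hb : π y ^ 3 = 1 := by rw [← map_pow, hy, map_one]
  have hab : (π x * π y) ^ 7 = 1 := by rw [← map_mul, ← map_pow, hxy, map_one]
  have hgen : Subgroup.closure {π x, π y} = ⊤ := by
    have hxy_gen : Subgroup.closure {x, y} = ⊤ := by
      rw [← PresentedGroup.closure_range_of triangleRels]
      congr 1
      ext g
      simp [Fin.exists_fin_two, x, y, eq_comm]
    rw [← Set.image_pair, ← MonoidHom.map_closure, hxy_gen,
      Subgroup.map_top_of_surjective π hπ]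
  exact ⟨six_le_card_of_triangle_relations ha hb hab hgen,
    exists_surjective_modularGroup ha hb hgen⟩
end

section
/- Let G be a group of order 12. Then G is generated by an element of order 2 together with an element of order 3 (i.e., there exist τ, σ ∈ G with orderOf τ = 2, orderOf σ = 3, and the subgroup generated by {τ, σ} equal to G) if and only if G is isomorphic to the alternating group A₄. -/
theorem Subgroup.eq_bot_or_eq_of_le_of_prime_card {G : Type*} [Group G] {H K : Subgroup G}
    (hK : (Nat.card K).Prime) (h : H ≤ K) : H = ⊥ ∨ H = K := by
  have : Finite K := Nat.finite_of_card_ne_zero hK.ne_zero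
  rcases hK.eq_one_or_self_of_dvd _ (Subgroup.card_dvd_of_le h) with h1 | h1
  · exact Or.inl (Subgroup.card_eq_one.mp h1)
  · exact Or.inr (Subgroup.eq_of_le_of_card_ge h h1.ge)

theorem Subgroup.index_zpowers_dvd_orderOf_of_closure_eq_top {G : Type*} [Group G] {τ σ : G}
    (h : Subgroup.closure ({τ, σ} : Set G) = ⊤) [(Subgroup.zpowers σ).Normal] :
    (Subgroup.zpowers σ).index ∣ orderOf τ := by
  have hσ : QuotientGroup.mk' (Subgroup.zpowers σ) σ = 1 :=
    (QuotientGroup.eq_one_iff σ).mpr (Subgroup.mem_zpowers σ)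
  have hgen : Subgroup.zpowers (QuotientGroup.mk' (Subgroup.zpowers σ) τ) = ⊤ := by
    rw [← Subgroup.map_top_of_surjective _ (QuotientGroup.mk'_surjective (Subgroup.zpowers σ)),
      ← h, MonoidHom.map_closure, Set.image_pair, hσ, Set.pair_comm, Subgroup.closure_insert_one,
      ← Subgroup.zpowers_eq_closure]
  rw [Subgroup.index, ← Subgroup.card_top, ← hgen, Nat.card_zpowers]
  exact orderOf_map_dvd _ τ

theorem nonempty_mulEquiv_alternatingGroup_of_normalCore_eq_bot {G : Type*} [Group G]
    (hG : Nat.card G = 12) {H : Subgroup G} (hH : H.index = 4) (hcore : H.normalCore = ⊥) :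
    Nonempty (G ≃* alternatingGroup (Fin 4)) := by
  classical
  have : H.FiniteIndex := ⟨by simp [hH]⟩
  have : Fintype (G ⧸ H) := Fintype.ofFinite _
  let f := MulAction.toPermHom G (G ⧸ H)
  have hf : Function.Injective f := by
    rw [← MonoidHom.ker_eq_bot_iff, ← Subgroup.normalCore_eq_ker, hcore]
  have hcard : Nat.card f.range = 12 := by
    rw [← hG]; exact (Nat.card_congr (MonoidHom.ofInjective hf).toEquiv).symm
  have hindex : f.range.index = 2 := by
    have h := f.range.card_mul_index
    rw [hcard, Nat.card_perm, ← Subgroup.index, hH, show Nat.factorial 4 = 24 from rfl] at h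
    lia
  have hrange : f.range = alternatingGroup (G ⧸ H) :=
    Equiv.Perm.eq_alternatingGroup_of_index_eq_two hindex
  have e : G ⧸ H ≃ Fin 4 := Finite.equivFinOfCardEq hH
  exact ⟨(MonoidHom.ofInjective hf).trans
    ((MulEquiv.subgroupCongr hrange).trans e.altCongrHom)⟩

theorem alternatingGroup_fin_four_exists_generators :
    ∃ τ σ : alternatingGroup (Fin 4), orderOf τ = 2 ∧ orderOf σ = 3 ∧
      Subgroup.closure ({τ, σ} : Set (alternatingGroup (Fin 4))) = ⊤ := by
  let τ : alternatingGroup (Fin 4) :=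
    ⟨Equiv.swap 0 1 * Equiv.swap 2 3, Equiv.Perm.mem_alternatingGroup.mpr (by decide)⟩
  let σ : alternatingGroup (Fin 4) :=
    ⟨Equiv.swap 0 1 * Equiv.swap 1 2, Equiv.Perm.mem_alternatingGroup.mpr (by decide)⟩
  have hdecomp : ∀ g : alternatingGroup (Fin 4),
      ∃ a b : Fin 3, g = σ ^ (a : ℕ) ∨ g = σ ^ (a : ℕ) * τ * σ ^ (b : ℕ) := by
    decide
  refine ⟨τ, σ, orderOf_eq_prime (by decide) (by decide),
    orderOf_eq_prime (by decide) (by decide), ?_⟩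
  rw [Subgroup.eq_top_iff']
  intro g
  have hτ : τ ∈ Subgroup.closure {τ, σ} := Subgroup.subset_closure (by simp)
  have hσ : σ ∈ Subgroup.closure {τ, σ} := Subgroup.subset_closure (by simp)
  obtain ⟨a, b, h | h⟩ := hdecomp g <;> rw [h]
  · exact pow_mem hσ _
  · exact mul_mem (mul_mem (pow_mem hσ _) hτ) (pow_mem hσ _)

theorem stmt_7 (G : Type) [Group G] (hG : Nat.card G = 12) :
    (∃ τ σ : G, orderOf τ = 2 ∧ orderOf σ = 3 ∧
      Subgroup.closure ({τ, σ} : Set G) = ⊤) ↔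
    Nonempty (G ≃* alternatingGroup (Fin 4)) := by
  constructor
  · rintro ⟨τ, σ, hτ, hσ, hgen⟩
    have hcard : Nat.card (Subgroup.zpowers σ) = 3 := by rw [Nat.card_zpowers, hσ]
    have hindex : (Subgroup.zpowers σ).index = 4 := by
      have h := (Subgroup.zpowers σ).card_mul_index
      lia
    rcases Subgroup.eq_bot_or_eq_of_le_of_prime_card (hcard ▸ Nat.prime_three)
      (Subgroup.normalCore_le (Subgroup.zpowers σ)) with hcore | hcore
    · exact nonempty_mulEquiv_alternatingGroup_of_normalCore_eq_bot hG hindex hcore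
    · have : (Subgroup.zpowers σ).Normal := hcore ▸ Subgroup.normalCore_normal _
      have h := Subgroup.index_zpowers_dvd_orderOf_of_closure_eq_top hgen
      rw [hindex, hτ] at h
      norm_num at h
  · rintro ⟨e⟩
    obtain ⟨τ, σ, hτ, hσ, hgen⟩ := alternatingGroup_fin_four_exists_generators
    refine ⟨e.symm τ, e.symm σ, by rw [MulEquiv.orderOf_eq, hτ],
      by rw [MulEquiv.orderOf_eq, hσ], ?_⟩
    rw [← Set.image_pair, ← MulEquiv.coe_toMonoidHom, ← MonoidHom.map_closure, hgen]
    exact Subgroup.map_top_of_surjective _ e.symm.surjective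
end

section
/- Let G be a group of order 18. Then G is generated by an element of order 2 together with an element of order 3 (i.e., there exist τ, σ ∈ G with orderOf τ = 2, orderOf σ = 3, and the subgroup generated by {τ, σ} equal to G) if and only if G is isomorphic to the direct product S₃ × ℤ/3ℤ. -/
/-- Commuting elements `w`, `z` of exponent 3 and an involution `τ` inverting `w` and
centralizing `z` define a homomorphism from `S₃ × ℤ/3ℤ`. -/
def permThreeProdLift {G : Type*} [Group G] (τ w z : G) (hτ : τ ^ 2 = 1) (hw : w ^ 3 = 1)
    (hz : z ^ 3 = 1) (hτw : τ * w = w ^ 2 * τ) (hτz : Commute τ z) (hwz : Commute w z) :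
    Equiv.Perm (Fin 3) × Multiplicative (ZMod 3) →* G :=
  MonoidHom.mk' (fun x => w ^ (x.1 0 : ℕ) * τ ^ (if Equiv.Perm.sign x.1 = 1 then 0 else 1) *
    z ^ (Multiplicative.toAdd x.2).val) <| by
    rintro ⟨p, s⟩ ⟨q, t⟩
    have hz_add : z ^ (Multiplicative.toAdd (s * t)).val =
        z ^ (Multiplicative.toAdd s).val * z ^ (Multiplicative.toAdd t).val := by
      rw [← pow_add, toAdd_mul, ZMod.val_add, ← pow_eq_pow_mod _ hz]
    have hw_apply : w ^ ((p * q) 0 : ℕ) =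
        w ^ (p 0 : ℕ) * w ^ (if Equiv.Perm.sign p = 1 then (q 0 : ℕ) else 2 * (q 0 : ℕ)) := by
      have key : ∀ p q : Equiv.Perm (Fin 3), ((p * q) 0 : ℕ) =
          ((p 0 : ℕ) + if Equiv.Perm.sign p = 1 then (q 0 : ℕ) else 2 * (q 0 : ℕ)) % 3 := by
        decide
      rw [← pow_add, key, ← pow_eq_pow_mod _ hw]
    have hτ_sign : τ ^ (if Equiv.Perm.sign (p * q) = 1 then 0 else 1) =
        τ ^ (if Equiv.Perm.sign p = 1 then 0 else 1) *
          τ ^ (if Equiv.Perm.sign q = 1 then 0 else 1) := by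
      have key : ∀ p q : Equiv.Perm (Fin 3), (if Equiv.Perm.sign (p * q) = 1 then 0 else 1) =
          ((if Equiv.Perm.sign p = 1 then 0 else 1) +
            (if Equiv.Perm.sign q = 1 then 0 else 1)) % 2 := by
        decide
      rw [← pow_add, key, ← pow_eq_pow_mod _ hτ]
    have hτ_comm : τ ^ (if Equiv.Perm.sign p = 1 then 0 else 1) * w ^ (q 0 : ℕ) =
        w ^ (if Equiv.Perm.sign p = 1 then (q 0 : ℕ) else 2 * (q 0 : ℕ)) *
          τ ^ (if Equiv.Perm.sign p = 1 then 0 else 1) := by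
      split_ifs
      · simp
      · have h : SemiconjBy τ w (w ^ 2) := hτw
        simpa [pow_mul] using (h.pow_right (q 0 : ℕ)).eq
    simp only [Prod.mk_mul_mk]
    rw [hz_add, hw_apply, hτ_sign]
    generalize (if Equiv.Perm.sign p = 1 then (q 0 : ℕ) else 2 * (q 0 : ℕ)) = a at *
    generalize (if Equiv.Perm.sign p = 1 then 0 else 1) = b at *
    generalize (if Equiv.Perm.sign q = 1 then 0 else 1) = c at *
    generalize (q 0 : ℕ) = d at *
    generalize (Multiplicative.toAdd s).val = m
    generalize (Multiplicative.toAdd t).val = n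
    have hzc : Commute (w ^ d * τ ^ c) (z ^ m) :=
      (hwz.pow_pow d m).mul_left (hτz.pow_pow c m)
    calc _ = w ^ (p 0 : ℕ) * (w ^ a * τ ^ b) * τ ^ c * z ^ m * z ^ n := by
          simp only [mul_assoc]
      _ = w ^ (p 0 : ℕ) * τ ^ b * ((w ^ d * τ ^ c) * z ^ m) * z ^ n := by
          rw [← hτ_comm]; simp only [mul_assoc]
      _ = _ := by rw [hzc.eq]; simp only [mul_assoc]

/-- In a group of order 18, an element of order 3 commutes with all its conjugates. -/
theorem commute_conj_of_card_eq_eighteen {G : Type*} [Group G] (hG : Nat.card G = 18)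
    {σ : G} (hσ : σ ^ 3 = 1) (g : G) : Commute σ (g * σ * g⁻¹) := by
  have : Finite G := Nat.finite_of_card_ne_zero (by omega)
  have : Fact (Nat.Prime 3) := ⟨Nat.prime_three⟩
  obtain ⟨P, hP⟩ := Sylow.exists_subgroup_card_pow_prime (G := G) 3 (n := 2)
    (by rw [hG]; norm_num)
  have hidx : P.index = 2 := by
    have := P.card_mul_index
    rw [hP, hG] at this
    omega
  have hσP : σ ∈ P := by
    have h := Subgroup.sq_mem_of_index_two hidx (σ ^ 2)
    rwa [← pow_mul, pow_succ σ 3, hσ, one_mul] at h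
  have hconj : g * σ * g⁻¹ ∈ P := (Subgroup.normal_of_index_eq_two hidx).conj_mem σ hσP g
  have hcomm := IsPGroup.isMulCommutative_of_card_eq_prime_sq (p := 3) (G := P) hP
  exact congrArg Subtype.val (hcomm.is_comm.comm (⟨σ, hσP⟩ : P) ⟨_, hconj⟩)

/-- A group of order 18 generated by elements of orders 2 and 3 is `S₃ × ℤ/3ℤ`. -/
theorem nonempty_mulEquiv_of_closure_eq_top {G : Type*} [Group G] (hG : Nat.card G = 18)
    {τ σ : G} (hτ : τ ^ 2 = 1) (hσ : σ ^ 3 = 1)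
    (hgen : Subgroup.closure ({τ, σ} : Set G) = ⊤) :
    Nonempty (G ≃* Equiv.Perm (Fin 3) × Multiplicative (ZMod 3)) := by
  have : Finite G := Nat.finite_of_card_ne_zero (by omega)
  obtain ⟨ρ, hρ⟩ : ∃ ρ, ρ = τ * σ * τ⁻¹ := ⟨_, rfl⟩
  have hc : Commute σ ρ := hρ ▸ commute_conj_of_card_eq_eighteen hG hσ τ
  have hρ3 : ρ ^ 3 = 1 := by rw [hρ, conj_pow, hσ]; simp
  have hτσ : SemiconjBy τ σ ρ := by simp [SemiconjBy, hρ]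
  have hτρ : SemiconjBy τ ρ σ := by
    have hinv : τ⁻¹ = τ := inv_eq_of_mul_eq_one_left (by rw [← sq, hτ])
    have h := hτσ.inv_symm_left
    rwa [hinv] at h
  have hρi : ρ⁻¹ = ρ ^ 2 := inv_eq_of_mul_eq_one_left (by rw [← pow_succ, hρ3])
  let w := σ * ρ ^ 2
  let z := σ * ρ
  have hw : w ^ 3 = 1 := by
    rw [(hc.pow_right 2).mul_pow, hσ, ← pow_mul, mul_comm, pow_mul, hρ3]; simp
  have hz : z ^ 3 = 1 := by rw [hc.mul_pow, hσ, hρ3, one_mul]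
  have hw2 : w ^ 2 = ρ * σ ^ 2 := by
    rw [(hc.pow_right 2).mul_pow, ← pow_mul, pow_succ ρ 3, hρ3, one_mul, (hc.pow_left 2).eq]
  have hτw : τ * w = w ^ 2 * τ := by
    rw [hw2]
    exact hτσ.mul_right (hτρ.pow_right 2)
  have hτz : Commute τ z := by
    have h : SemiconjBy τ (σ * ρ) (ρ * σ) := hτσ.mul_right hτρ
    rwa [← hc.eq] at h
  have hσz : Commute σ z := (Commute.refl σ).mul_right hc
  have hρz : Commute ρ z := hc.symm.mul_right (Commute.refl ρ)
  have hwz : Commute w z := hσz.mul_left (hρz.pow_left 2)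
  let f := permThreeProdLift τ w z hτ hw hz hτw hτz hwz
  have hfτ : f (Equiv.swap 1 2, 1) = τ := by
    change w ^ 0 * τ ^ 1 * z ^ 0 = τ
    simp
  have hfσ : f (finRotate 3 ^ 2, Multiplicative.ofAdd 2) = σ := by
    change w ^ 2 * τ ^ 0 * z ^ 2 = σ
    rw [hw2, pow_zero, mul_one, hc.mul_pow, ← (hc.pow_left 2).eq]
    calc σ ^ 2 * ρ * (σ ^ 2 * ρ ^ 2) = σ ^ 2 * (ρ * σ ^ 2) * ρ ^ 2 := by simp only [mul_assoc]
      _ = σ ^ 3 * σ * ρ ^ 3 := by rw [← (hc.pow_left 2).eq]; group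
      _ = σ := by rw [hσ, hρ3]; simp
  have hsurj : Function.Surjective f := by
    rw [← MonoidHom.range_eq_top, eq_top_iff, ← hgen, Subgroup.closure_le]
    rintro _ (rfl | rfl)
    exacts [⟨_, hfτ⟩, ⟨_, hfσ⟩]
  have hcard : Nat.card (Equiv.Perm (Fin 3) × Multiplicative (ZMod 3)) = Nat.card G := by
    rw [hG, Nat.card_prod, Nat.card_perm, Nat.card_fin, Nat.card_congr Multiplicative.toAdd,
      Nat.card_zmod]
    rfl
  have hbij : Function.Bijective f :=
    (Nat.bijective_iff_surjective_and_card f).2 ⟨hsurj, hcard⟩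
  exact ⟨(MulEquiv.ofBijective f hbij).symm⟩

/-- `S₃ × ℤ/3ℤ` is generated by a transposition and a diagonal element of order 3. -/
theorem closure_swap_finRotate_eq_top :
    Subgroup.closure ({(Equiv.swap 1 2, 1), (finRotate 3, Multiplicative.ofAdd 1)} :
      Set (Equiv.Perm (Fin 3) × Multiplicative (ZMod 3))) = ⊤ := by
  rw [eq_top_iff]
  rintro x -
  have key : ∀ x : Equiv.Perm (Fin 3) × ZMod 3, ∃ a b c : Fin 3,
      x = ((Equiv.swap 1 2 ^ (a : ℕ) * finRotate 3 ^ (b : ℕ)) *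
        (Equiv.swap 1 2 * finRotate 3 * Equiv.swap 1 2) ^ (c : ℕ), ((b + c : ℕ) : ZMod 3)) := by
    decide
  obtain ⟨a, b, c, h⟩ := key (x.1, x.2.toAdd)
  set T : Equiv.Perm (Fin 3) × Multiplicative (ZMod 3) := (Equiv.swap 1 2, 1) with hT
  set S : Equiv.Perm (Fin 3) × Multiplicative (ZMod 3) :=
    (finRotate 3, Multiplicative.ofAdd 1) with hS
  have hx : x = T ^ (a : ℕ) * S ^ (b : ℕ) * (T * S * T) ^ (c : ℕ) := by
    rw [Prod.mk.injEq] at h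
    refine Prod.ext h.1 (Multiplicative.toAdd.injective ?_)
    simp [hT, hS, h.2]
  have hTm : T ∈ Subgroup.closure {T, S} := Subgroup.subset_closure (by simp)
  have hSm : S ∈ Subgroup.closure {T, S} := Subgroup.subset_closure (by simp)
  rw [hx]
  exact mul_mem (mul_mem (pow_mem hTm _) (pow_mem hSm _))
    (pow_mem (mul_mem (mul_mem hTm hSm) hTm) _)

theorem orderOf_swap_one :
    orderOf ((Equiv.swap 1 2, 1) : Equiv.Perm (Fin 3) × Multiplicative (ZMod 3)) = 2 :=
  orderOf_eq_prime (by decide) (by decide)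

theorem orderOf_finRotate_ofAdd :
    orderOf ((finRotate 3, Multiplicative.ofAdd 1) :
      Equiv.Perm (Fin 3) × Multiplicative (ZMod 3)) = 3 :=
  have : Fact (Nat.Prime 3) := ⟨Nat.prime_three⟩
  orderOf_eq_prime (by decide) (by decide)

theorem stmt_8 (G : Type) [Group G] (hG : Nat.card G = 18) :
    (∃ τ σ : G, orderOf τ = 2 ∧ orderOf σ = 3 ∧
      Subgroup.closure ({τ, σ} : Set G) = ⊤) ↔
    Nonempty (G ≃* Equiv.Perm (Fin 3) × Multiplicative (ZMod 3)) := by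
  constructor
  · rintro ⟨τ, σ, hτ, hσ, hgen⟩
    exact nonempty_mulEquiv_of_closure_eq_top hG (hτ ▸ pow_orderOf_eq_one τ)
      (hσ ▸ pow_orderOf_eq_one σ) hgen
  · rintro ⟨e⟩
    refine ⟨e.symm (Equiv.swap 1 2, 1), e.symm (finRotate 3, Multiplicative.ofAdd 1), ?_, ?_, ?_⟩
    · rw [MulEquiv.orderOf_eq]
      exact orderOf_swap_one
    · rw [MulEquiv.orderOf_eq]
      exact orderOf_finRotate_ofAdd
    · have h := congrArg (Subgroup.map e.symm.toMonoidHom) closure_swap_finRotate_eq_top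
      rw [MonoidHom.map_closure, Set.image_pair,
        Subgroup.map_top_of_surjective _ e.symm.surjective] at h
      exact h
end

section
/- Let G be a group of order 24. Then G is generated by an element of order 2 together with an element of order 3 (i.e., there exist τ, σ ∈ G with orderOf τ = 2, orderOf σ = 3, and the subgroup generated by {τ, σ} equal to G) if and only if G is isomorphic to the symmetric group S₄ or to the direct product A₄ × ℤ/2ℤ. -/
open Equiv

/-- A word form that suffices to recognise that two elements generate a small group. -/
theorem closure_pair_eq_top_of_words {G : Type*} [Group G] (t s : G)
    (h : ∀ g : G, ∃ (i : Fin 3) (j : Fin 2) (k : Fin 3) (l : Fin 2) (m : Fin 3) (n : Fin 2)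
      (o : Fin 3), s ^ i.val * t ^ j.val * s ^ k.val * t ^ l.val * s ^ m.val * t ^ n.val *
        s ^ o.val = g) :
    Subgroup.closure ({t, s} : Set G) = ⊤ := by
  refine eq_top_iff.2 fun g _ => ?_
  obtain ⟨i, j, k, l, m, n, o, rfl⟩ := h g
  have ht : t ∈ Subgroup.closure ({t, s} : Set G) := Subgroup.subset_closure (by simp)
  have hs : s ∈ Subgroup.closure ({t, s} : Set G) := Subgroup.subset_closure (by simp)
  have hpt := fun n : ℕ => pow_mem ht n
  have hps := fun n : ℕ => pow_mem hs n
  exact mul_mem (mul_mem (mul_mem (mul_mem (mul_mem (mul_mem (hps _) (hpt _)) (hps _)) (hpt _))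
    (hps _)) (hpt _)) (hps _)

set_option maxRecDepth 100000 in
theorem perm_four_generated :
    ∃ t s : Perm (Fin 4), orderOf t = 2 ∧ orderOf s = 3 ∧
      Subgroup.closure ({t, s} : Set (Perm (Fin 4))) = ⊤ :=
  ⟨swap 0 1, swap 1 2 * swap 2 3, orderOf_eq_prime (by decide) (by decide),
    orderOf_eq_prime (by decide) (by decide), closure_pair_eq_top_of_words _ _ (by decide)⟩

set_option maxRecDepth 100000 in
theorem alternatingGroup_four_prod_generated :
    ∃ t s : alternatingGroup (Fin 4) × Multiplicative (ZMod 2), orderOf t = 2 ∧ orderOf s = 3 ∧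
      Subgroup.closure ({t, s} : Set (alternatingGroup (Fin 4) × Multiplicative (ZMod 2))) = ⊤ :=
  ⟨(⟨swap 0 1 * swap 2 3, by rw [Perm.mem_alternatingGroup]; decide⟩, Multiplicative.ofAdd 1),
    (⟨swap 0 1 * swap 1 2, by rw [Perm.mem_alternatingGroup]; decide⟩, 1),
    orderOf_eq_prime (by decide) (by decide), orderOf_eq_prime (by decide) (by decide),
    closure_pair_eq_top_of_words _ _ (by decide)⟩

theorem MulEquiv.exists_generators_of_orders {G H : Type*} [Group G] [Group H] (e : H ≃* G)
    {m n : ℕ} (h : ∃ t s : H, orderOf t = m ∧ orderOf s = n ∧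
      Subgroup.closure ({t, s} : Set H) = ⊤) :
    ∃ t s : G, orderOf t = m ∧ orderOf s = n ∧ Subgroup.closure ({t, s} : Set G) = ⊤ := by
  obtain ⟨t, s, ht, hs, h⟩ := h
  refine ⟨e t, e s, by rw [MulEquiv.orderOf_eq, ht], by rw [MulEquiv.orderOf_eq, hs], ?_⟩
  have := congrArg (Subgroup.map e.toMonoidHom) h
  rw [MonoidHom.map_closure, Subgroup.map_top_of_surjective _ e.surjective] at this
  simpa [Set.image_pair] using this

theorem card_closure_pair_le_twelve {G : Type*} [Group G] {x s : G} (hx : x ^ 2 = 1)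
    (hs : s ^ 3 = 1) (hxs : (x * s) ^ 3 = 1) :
    Nat.card (Subgroup.closure ({x, s} : Set G)) ≤ 12 := by
  obtain ⟨b, hb⟩ : ∃ b, b = s * x * s⁻¹ := ⟨_, rfl⟩
  obtain ⟨c, hc⟩ : ∃ c, c = s * b * s⁻¹ := ⟨_, rfl⟩
  have hxx : x * x = 1 := by rw [← pow_two, hx]
  have hcc : c * c = 1 := by
    have : c * c = s * s * (x * x) * (s⁻¹ * s⁻¹) := by rw [hc, hb]; group
    rw [this, hxx]; group
  have hss : s * (s * s) = 1 := by rw [← hs, pow_succ', pow_two]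
  have hsi : s⁻¹ = s * s := inv_eq_of_mul_eq_one_right hss
  have hxi : x⁻¹ = x := inv_eq_of_mul_eq_one_right hxx
  have hxbc : x * b * c = 1 := by
    have h1 : x * b * c * s ^ 3 = (x * s) ^ 3 := by
      rw [hc, hb]; simp only [pow_succ, pow_zero]; group
    rwa [hxs, hs, mul_one] at h1
  have hxb : x * b = c := by
    rw [mul_eq_one_iff_eq_inv.1 hxbc]; exact inv_eq_of_mul_eq_one_right hcc
  have hxc : x * c = b := by rw [← hxb, ← mul_assoc, hxx, one_mul]
  have hsx : s * x = b * s := by rw [hb]; group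
  have hsb : s * b = c * s := by rw [hc]; group
  have hsc : s * c = x * s := by
    have : s * c = (s * (s * s)) * x * (s * (s * s))⁻¹ * s := by rw [hc, hb]; group
    rw [this, hss]; group
  have hxS : ∀ i : Fin 4, ∃ j : Fin 4, x * ![1, x, b, c] i = ![1, x, b, c] j := by
    intro i
    fin_cases i
    · exact ⟨1, by simp⟩
    · exact ⟨0, by simpa using hxx⟩
    · exact ⟨3, by simpa using hxb⟩
    · exact ⟨2, by simpa using hxc⟩
  have hsS : ∀ i : Fin 4, ∃ j : Fin 4, s * ![1, x, b, c] i = ![1, x, b, c] j * s := by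
    intro i
    fin_cases i
    · exact ⟨0, by simp⟩
    · exact ⟨2, by simpa using hsx⟩
    · exact ⟨3, by simpa using hsb⟩
    · exact ⟨1, by simpa using hsc⟩
  have hsT : ∀ i : Fin 3, ∃ j : Fin 3, s * ![1, s, s * s] i = ![1, s, s * s] j := by
    intro i
    fin_cases i
    · exact ⟨1, by simp⟩
    · exact ⟨2, by simp⟩
    · exact ⟨0, by simpa using hss⟩
  let f : Fin 4 × Fin 3 → G := fun p => ![1, x, b, c] p.1 * ![1, s, s * s] p.2
  have hfx : ∀ y ∈ Set.range f, x * y ∈ Set.range f := by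
    rintro _ ⟨⟨i, j⟩, rfl⟩
    obtain ⟨k, hk⟩ := hxS i
    exact ⟨(k, j), by simp only [f]; rw [← mul_assoc, hk]⟩
  have hfs : ∀ y ∈ Set.range f, s * y ∈ Set.range f := by
    rintro _ ⟨⟨i, j⟩, rfl⟩
    obtain ⟨k, hk⟩ := hsS i
    obtain ⟨l, hl⟩ := hsT j
    exact ⟨(k, l), by simp only [f]; rw [← mul_assoc, hk, ← hl, mul_assoc]⟩
  have hsub : (Subgroup.closure ({x, s} : Set G) : Set G) ⊆ Set.range f := by
    intro g hg
    induction hg using Subgroup.closure_induction_left with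
    | one => exact ⟨(0, 0), by simp [f]⟩
    | mul_left y hy z _ hz =>
      rcases hy with rfl | rfl
      exacts [hfx _ hz, hfs _ hz]
    | inv_mul_cancel y hy z _ hz =>
      rcases hy with rfl | rfl
      · rw [hxi]; exact hfx _ hz
      · rw [hsi, mul_assoc]; exact hfs _ (hfs _ hz)
  calc Nat.card (Subgroup.closure ({x, s} : Set G)) ≤ Nat.card (Set.range f) :=
        Nat.card_mono (Set.finite_range f) hsub
    _ ≤ Nat.card (Fin 4 × Fin 3) := Finite.card_range_le f
    _ = 12 := by simp

theorem closure_pair_card_le_of_normal {G : Type*} [Group G] {t s : G}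
    (h : (Subgroup.zpowers s).Normal) :
    Nat.card (Subgroup.closure ({t, s} : Set G)) ≤ orderOf t * orderOf s := by
  have : Subgroup.closure ({t, s} : Set G) = Subgroup.zpowers t ⊔ Subgroup.zpowers s := by
    rw [Set.insert_eq, Subgroup.closure_union, ← Subgroup.zpowers_eq_closure,
      ← Subgroup.zpowers_eq_closure]
  rw [this, ← Nat.card_zpowers, ← Nat.card_zpowers]
  have h2 := Set.natCard_mul_le (s := (Subgroup.zpowers t : Set G)) (t := Subgroup.zpowers s)
  rw [← Subgroup.mul_normal] at h2
  exact h2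

theorem factorization_twentyfour_three : (24 : ℕ).factorization 3 = 1 := by
  rw [show 24 = 3 * 8 by norm_num, Nat.factorization_eq_of_coprime_left (by norm_num) (by simp)]
  exact Nat.prime_three.factorization_self

theorem card_sylow_three_of_generated {G : Type*} [Group G] (hG : Nat.card G = 24) {t s : G}
    (ht : orderOf t = 2) (hs : orderOf s = 3)
    (h : Subgroup.closure ({t, s} : Set G) = ⊤) : Nat.card (Sylow 3 G) = 4 := by
  have : Finite G := Nat.finite_of_card_ne_zero (by omega)
  let P : Sylow 3 G := Sylow.ofCard (Subgroup.zpowers s) (by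
    rw [hG, factorization_twentyfour_three, Nat.card_zpowers, hs, pow_one])
  have hP : (P : Subgroup G) = Subgroup.zpowers s := rfl
  have hcard : Nat.card (P : Subgroup G) = 3 := by rw [hP, Nat.card_zpowers, hs]
  have hi : (P : Subgroup G).index = 8 := by
    have := (P : Subgroup G).card_mul_index
    rw [hG] at this
    rw [hcard] at this
    omega
  have hd := P.card_dvd_index
  rw [hi] at hd
  have hm := card_sylow_modEq_one 3 G
  have hne : Nat.card (Sylow 3 G) ≠ 1 := by
    intro h1
    have hN : (Subgroup.zpowers s).Normal := by
      rw [P.card_eq_index_normalizer, Subgroup.index_eq_one] at h1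
      rw [← hP]
      exact Subgroup.normalizer_eq_top_iff.1 h1
    have := closure_pair_card_le_of_normal (t := t) hN
    rw [h, ht, hs, Subgroup.card_top, hG] at this
    omega
  have := Nat.le_of_dvd (by norm_num) hd
  generalize Nat.card (Sylow 3 G) = n at *
  unfold Nat.ModEq at hm
  interval_cases n <;> omega

theorem card_ker_toPermHom_sylow_three {G : Type*} [Group G] (hG : Nat.card G = 24)
    (h4 : Nat.card (Sylow 3 G) = 4) :
    Nat.card (MulAction.toPermHom G (Sylow 3 G)).ker = 1 ∨
      Nat.card (MulAction.toPermHom G (Sylow 3 G)).ker = 2 := by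
  have : Finite G := Nat.finite_of_card_ne_zero (by omega)
  set K := (MulAction.toPermHom G (Sylow 3 G)).ker with hK
  have hKN : ∀ P : Sylow 3 G, K ≤ Subgroup.normalizer (P : Set G) := by
    intro P g hg
    rw [← Sylow.smul_eq_iff_mem_normalizer]
    have := congrArg (fun e : Perm (Sylow 3 G) => e P) (MonoidHom.mem_ker.1 hg)
    simpa using this
  have hcardP : ∀ P : Sylow 3 G, Nat.card (P : Subgroup G) = 3 := by
    intro P
    have := P.card_eq_multiplicity
    rwa [hG, factorization_twentyfour_three, pow_one] at this
  obtain ⟨P⟩ : Nonempty (Sylow 3 G) := inferInstance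
  have hN : Nat.card (Subgroup.normalizer (P : Set G)) = 6 := by
    have h1 := (Subgroup.normalizer (P : Set G)).card_mul_index
    have h2 := P.card_eq_index_normalizer
    rw [← h2, h4, hG] at h1
    omega
  have hd : Nat.card K ∣ 6 := hN ▸ Subgroup.card_dvd_of_le (hKN P)
  have h3 : ¬ 3 ∣ Nat.card K := by
    intro h3
    obtain ⟨g, hg⟩ := exists_prime_orderOf_dvd_card' 3 h3
    have hg' : orderOf (g : G) = 3 := by rw [Subgroup.orderOf_coe, hg]
    have hz : Nat.card (Subgroup.zpowers (g : G)) = 3 := by rw [Nat.card_zpowers, hg']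
    have heq : ∀ Q : Sylow 3 G, Subgroup.zpowers (g : G) = Q := by
      intro Q
      have h5 := (IsPGroup.of_card (p := 3) (n := 1) (hz.trans (pow_one 3).symm)).inf_normalizer_sylow Q
      have h6 : Subgroup.zpowers (g : G) ≤ Subgroup.normalizer (Q : Set G) := by
        rw [Subgroup.zpowers_le]; exact hKN Q g.2
      rw [inf_eq_left.2 h6] at h5
      exact Subgroup.eq_of_le_of_card_ge (inf_eq_left.1 h5.symm) (by rw [hcardP, hz])
    have : Subsingleton (Sylow 3 G) :=
      ⟨fun A B => Sylow.ext ((heq A).symm.trans (heq B))⟩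
    have := Finite.card_le_one_iff_subsingleton.2 this
    omega
  have := Nat.le_of_dvd (by norm_num) hd
  generalize Nat.card K = n at *
  interval_cases n <;> omega

theorem commute_of_mem_normal_card_two {G : Type*} [Group G] {K : Subgroup G} [K.Normal]
    (hK : Nat.card K = 2) {w : G} (hw : w ∈ K) (g : G) : Commute g w := by
  by_cases h1 : w = 1
  · rw [h1]; exact Commute.one_right g
  obtain ⟨y, hy⟩ := (Nat.card_eq_two_iff' (1 : K)).1 hK
  have e1 := hy.2 ⟨w, hw⟩ (by simpa [Subtype.ext_iff] using h1)
  have e2 := hy.2 ⟨g * w * g⁻¹, Subgroup.Normal.conj_mem inferInstance w hw g⟩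
    (by simpa [Subtype.ext_iff] using h1)
  have := congrArg Subtype.val (e2.trans e1.symm)
  exact mul_inv_eq_iff_eq_mul.1 this

set_option maxRecDepth 100000 in
theorem alternatingGroup_four_mul_pow_three : ∀ t s : Perm (Fin 4), Perm.sign t = 1 →
    t ^ 2 = 1 → s ^ 3 = 1 → s ≠ 1 → (t * s) ^ 3 = 1 := by
  decide

theorem equiv_prod_of_ker_card_two {G A : Type*} [Group G] [Group A] [Finite G]
    (φ : G →* A) (hφ : Function.Surjective φ) (hK : Nat.card φ.ker = 2)
    (H : Subgroup G) (hH : Nat.card H ≤ Nat.card A) (hHA : H.map φ = ⊤) :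
    Nonempty (G ≃* A × Multiplicative (ZMod 2)) := by
  have : Finite A := Finite.of_surjective φ hφ
  have hs : Function.Surjective (φ.comp H.subtype) := by
    intro a
    obtain ⟨g, hg, rfl⟩ : a ∈ H.map φ := hHA ▸ Subgroup.mem_top a
    exact ⟨⟨g, hg⟩, rfl⟩
  have hc : Nat.card H = Nat.card A :=
    le_antisymm hH (Nat.card_le_card_of_surjective _ hs)
  have hb : Function.Bijective (φ.comp H.subtype) := hs.bijective_of_nat_card_le hc.le
  let e₁ : H ≃* A := MulEquiv.ofBijective _ hb
  have : Fact (Nat.Prime 2) := ⟨Nat.prime_two⟩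
  let e₂ : φ.ker ≃* Multiplicative (ZMod 2) := mulEquivOfPrimeCardEq (p := 2) hK (by simp)
  let ψ := H.subtype.noncommCoprod φ.ker.subtype
    fun m n => commute_of_mem_normal_card_two hK n.2 (m : G)
  have hinj : Function.Injective ψ := by
    refine (MonoidHom.noncommCoprod_injective _ _ _).2
      ⟨H.subtype_injective, φ.ker.subtype_injective, ?_⟩
    rw [Subgroup.range_subtype, Subgroup.range_subtype, Subgroup.disjoint_def]
    intro x hx hxk
    have := @hb.1 ⟨x, hx⟩ 1 (by simpa using hxk)
    simpa [Subtype.ext_iff] using this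
  have hcard : Nat.card G = Nat.card (H × φ.ker) := by
    rw [Nat.card_prod, hc, ← φ.ker.card_mul_index, Subgroup.index_ker,
      MonoidHom.range_eq_top.2 hφ, Subgroup.card_top, mul_comm]
  have hψ : Function.Bijective ψ := hinj.bijective_of_nat_card_le hcard.le
  exact ⟨(MulEquiv.ofBijective ψ hψ).symm.trans (e₁.prodCongr e₂)⟩

theorem equiv_of_generated {G : Type*} [Group G] (hG : Nat.card G = 24) {t s : G}
    (ht : orderOf t = 2) (hs : orderOf s = 3)
    (h : Subgroup.closure ({t, s} : Set G) = ⊤) :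
    Nonempty (G ≃* Perm (Fin 4)) ∨
      Nonempty (G ≃* alternatingGroup (Fin 4) × Multiplicative (ZMod 2)) := by
  have : Finite G := Nat.finite_of_card_ne_zero (by omega)
  have h4 := card_sylow_three_of_generated hG ht hs h
  let e : Sylow 3 G ≃ Fin 4 := Finite.equivFinOfCardEq h4
  let φ : G →* Perm (Fin 4) :=
    e.permCongrHom.toMonoidHom.comp (MulAction.toPermHom G (Sylow 3 G))
  have hker : φ.ker = (MulAction.toPermHom G (Sylow 3 G)).ker :=
    MonoidHom.ker_mulEquiv_comp _ e.permCongrHom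
  have hS4 : Nat.card (Perm (Fin 4)) = 24 := by
    rw [Nat.card_perm, Nat.card_fin]; rfl
  have hK := card_ker_toPermHom_sylow_three hG h4
  rw [← hker] at hK
  rcases hK with hK | hK
  · left
    have hinj : Function.Injective φ :=
      (MonoidHom.ker_eq_bot_iff φ).1 (Subgroup.card_eq_one.1 hK)
    exact ⟨MulEquiv.ofBijective φ (hinj.bijective_of_nat_card_le (by rw [hG, hS4]))⟩
  · right
    have hrange : φ.range = alternatingGroup (Fin 4) := by
      apply Perm.eq_alternatingGroup_of_index_eq_two
      have h1 := φ.ker.card_mul_index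
      have h2 := φ.range.card_mul_index
      rw [Subgroup.index_ker, hK, hG] at h1
      rw [hS4] at h2
      have h3 : Nat.card φ.range = 12 := by omega
      rw [h3] at h2
      omega
    have hmem : ∀ g, φ g ∈ alternatingGroup (Fin 4) := fun g => hrange ▸ ⟨g, rfl⟩
    let χ : G →* alternatingGroup (Fin 4) := φ.codRestrict _ hmem
    have hχk : χ.ker = φ.ker := MonoidHom.ker_codRestrict _ _ _
    have hχ : Function.Surjective χ := by
      rintro ⟨a, ha⟩
      rw [← hrange] at ha
      obtain ⟨g, rfl⟩ := ha
      exact ⟨g, rfl⟩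
    have ht2 : t ^ 2 = 1 := ht ▸ pow_orderOf_eq_one t
    have hs3 : s ^ 3 = 1 := hs ▸ pow_orderOf_eq_one s
    have hφs : φ s ≠ 1 := by
      intro h1
      have h2 := Subgroup.orderOf_dvd_natCard φ.ker (MonoidHom.mem_ker.2 h1)
      rw [hs, hK] at h2
      omega
    obtain ⟨w, hw⟩ : ∃ w, w = (t * s) ^ 3 := ⟨_, rfl⟩
    have hwK : w ∈ φ.ker := by
      rw [hw, MonoidHom.mem_ker, map_pow, map_mul]
      exact alternatingGroup_four_mul_pow_three _ _ (Perm.mem_alternatingGroup.1 (hmem t))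
        (by rw [← map_pow, ht2, map_one]) (by rw [← map_pow, hs3, map_one]) hφs
    have hw2 : w ^ 2 = 1 := by
      have := pow_card_eq_one' (x := (⟨w, hwK⟩ : φ.ker))
      rw [hK] at this
      simpa [Subtype.ext_iff] using this
    have hcomm := fun g => commute_of_mem_normal_card_two hK hwK g
    have hA : Nat.card (alternatingGroup (Fin 4)) = 12 :=
      alternatingGroup.card_of_card_eq_four (by simp)
    refine equiv_prod_of_ker_card_two χ hχ (hχk ▸ hK)
      (Subgroup.closure ({t * w, s} : Set G)) ?_ ?_
    · rw [hA]
      refine card_closure_pair_le_twelve ?_ hs3 ?_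
      · rw [(hcomm t).mul_pow, ht2, hw2, one_mul]
      · rw [mul_assoc, ← (hcomm s).eq, ← mul_assoc, (hcomm (t * s)).mul_pow, ← hw, ← pow_succ']
        rw [show 3 + 1 = 2 * 2 by norm_num, pow_mul, hw2, one_pow]
    · have hχw : χ w = 1 := by
        rw [← MonoidHom.mem_ker, hχk]; exact hwK
      rw [MonoidHom.map_closure, Set.image_pair, map_mul, hχw, mul_one, ← Set.image_pair,
        ← MonoidHom.map_closure, h, Subgroup.map_top_of_surjective _ hχ]

theorem stmt_9 (G : Type) [Group G] (hG : Nat.card G = 24) :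
    (∃ τ σ : G, orderOf τ = 2 ∧ orderOf σ = 3 ∧
      Subgroup.closure ({τ, σ} : Set G) = ⊤) ↔
    (Nonempty (G ≃* Equiv.Perm (Fin 4)) ∨
      Nonempty (G ≃* alternatingGroup (Fin 4) × Multiplicative (ZMod 2))) := by
  constructor
  · rintro ⟨τ, σ, hτ, hσ, h⟩
    exact equiv_of_generated hG hτ hσ h
  · rintro (he | he) <;> obtain ⟨e⟩ := he
    · exact e.symm.exists_generators_of_orders perm_four_generated
    · exact e.symm.exists_generators_of_orders alternatingGroup_four_prod_generated
end

section
/- No group of order 66 is generated by an element of order 2 together with an element of order 3: for every group G with |G| = 66 there do not exist τ, σ ∈ G with orderOf τ = 2, orderOf σ = 3, and the subgroup generated by {τ, σ} equal to all of G. -/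
/-- A group of order 66 has a normal subgroup generated by an element of order 11. -/
theorem exists_orderOf_eq_eleven_of_card_eq (G : Type) [Group G] (hG : Nat.card G = 66) :
    ∃ x : G, orderOf x = 11 ∧ (Subgroup.zpowers x).Normal := by
  have : Finite G := Nat.finite_of_card_ne_zero (by omega)
  have : Fact (Nat.Prime 11) := ⟨by norm_num⟩
  obtain ⟨P⟩ : Nonempty (Sylow 11 G) := inferInstance
  have hP : Nat.card P = 11 := by
    have hfac : (66 : ℕ).factorization 11 = 1 := by
      rw [show (66 : ℕ) = 11 * 6 by norm_num, Nat.factorization_mul (by norm_num) (by norm_num),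
        Finsupp.add_apply, Nat.Prime.factorization_self (by norm_num),
        Nat.factorization_eq_zero_of_not_dvd (by norm_num)]
    rw [P.card_eq_multiplicity, hG, hfac, pow_one]
  have hidx : (P : Subgroup G).index = 6 := by
    have h := (P : Subgroup G).card_mul_index
    rw [hG] at h
    change Nat.card P * _ = 66 at h
    rw [hP] at h
    omega
  have hcard : Nat.card (Sylow 11 G) = 1 := by
    have hdvd : Nat.card (Sylow 11 G) ∣ 6 := hidx ▸ P.card_dvd_index
    have hmod : Nat.card (Sylow 11 G) % 11 = 1 := card_sylow_modEq_one 11 G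
    have hle := Nat.le_of_dvd (by norm_num) hdvd
    omega
  have : Subsingleton (Sylow 11 G) := (Nat.card_eq_one_iff_unique.mp hcard).1
  have hnormal : (P : Subgroup G).Normal := P.normal_of_subsingleton
  obtain ⟨x, hx⟩ := exists_prime_orderOf_dvd_card' (G := P) 11 (by rw [hP])
  have hx' : orderOf (x : G) = 11 := by rw [Subgroup.orderOf_coe, hx]
  refine ⟨x, hx', ?_⟩
  have hzP : Subgroup.zpowers (x : G) = P := by
    apply Subgroup.eq_of_le_of_card_ge
    · rw [Subgroup.zpowers_le]
      exact x.2
    · rw [hP, Nat.card_zpowers, hx']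
  rw [hzP]
  exact hnormal

/-- An element of order 3 normalizing a cyclic group of order 11 centralizes it. -/
theorem commute_of_orderOf_three_of_orderOf_eleven {G : Type} [Group G] {x σ : G}
    (hx : orderOf x = 11) (hσ : orderOf σ = 3) (hn : (Subgroup.zpowers x).Normal) :
    Commute x σ := by
  obtain ⟨k, hk⟩ := hn.conj_mem x (Subgroup.mem_zpowers x) σ
  change x ^ k = σ * x * σ⁻¹ at hk
  have hconj (m : ℤ) : σ * x ^ m * σ⁻¹ = x ^ (k * m) := by
    rw [← conj_zpow, ← hk, zpow_mul]
  have hσ3 : σ ^ 3 = 1 := hσ ▸ pow_orderOf_eq_one σ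
  have hk3 : x ^ (k * (k * k)) = x ^ (1 : ℤ) := by
    rw [← hconj, ← hconj, hk, zpow_one]
    calc σ * (σ * (σ * x * σ⁻¹) * σ⁻¹) * σ⁻¹ = σ ^ 3 * x * (σ ^ 3)⁻¹ := by
          simp only [pow_succ, pow_zero, one_mul, mul_inv_rev, mul_assoc]
      _ = x := by simp [hσ3]
  rw [zpow_eq_zpow_iff_modEq, hx, ← ZMod.intCast_eq_intCast_iff] at hk3
  have hcube : ∀ a : ZMod 11, a * (a * a) = 1 → a = 1 := by decide
  have hk1 : (k : ZMod 11) = (1 : ℤ) := by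
    push_cast at hk3 ⊢
    exact hcube _ hk3
  have hxk : x ^ k = x ^ (1 : ℤ) := by
    rw [zpow_eq_zpow_iff_modEq, hx, ← ZMod.intCast_eq_intCast_iff]
    exact hk1
  rw [hk, zpow_one] at hxk
  exact (mul_inv_eq_iff_eq_mul.mp hxk).symm

/-- In a group of order 66, every element of order 3 generates a normal subgroup. -/
theorem normal_zpowers_of_orderOf_three (G : Type) [Group G] (hG : Nat.card G = 66) {σ : G}
    (hσ : orderOf σ = 3) : (Subgroup.zpowers σ).Normal := by
  obtain ⟨x, hx, hn⟩ := exists_orderOf_eq_eleven_of_card_eq G hG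
  have hc := commute_of_orderOf_three_of_orderOf_eleven hx hσ hn
  have hord : orderOf (x * σ) = 33 := by
    rw [hc.orderOf_mul_eq_mul_orderOf_of_coprime (by rw [hx, hσ]; norm_num), hx, hσ]
  have hidx : (Subgroup.zpowers (x * σ)).index = 2 := by
    have h := (Subgroup.zpowers (x * σ)).card_mul_index
    rw [hG, Nat.card_zpowers, hord] at h
    omega
  have hN := Subgroup.normal_of_index_eq_two hidx
  have hσ3 : σ ^ 3 = 1 := hσ ▸ pow_orderOf_eq_one σ
  have hx11 : x ^ 11 = 1 := hx ▸ pow_orderOf_eq_one x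
  have hmem : σ ∈ Subgroup.zpowers (x * σ) := by
    refine ⟨22, ?_⟩
    change (x * σ) ^ (22 : ℤ) = σ
    rw [hc.mul_zpow, show (22 : ℤ) = ((11 * 2 : ℕ) : ℤ) by norm_num, zpow_natCast, zpow_natCast,
      pow_mul, hx11, one_pow, one_mul, show 11 * 2 = 3 * 7 + 1 by norm_num, pow_succ, pow_mul,
      hσ3, one_pow, one_mul]
  have hconj (g : G) : g * σ * g⁻¹ ∈ Subgroup.zpowers σ := by
    obtain ⟨m, hm⟩ := hN.conj_mem σ hmem g
    change (x * σ) ^ m = g * σ * g⁻¹ at hm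
    have hcube : (x * σ) ^ (m * 3) = 1 := by
      rw [zpow_mul, hm]
      change (g * σ * g⁻¹) ^ ((3 : ℕ) : ℤ) = 1
      rw [zpow_natCast, conj_pow, hσ3, mul_one, mul_inv_cancel]
    have hdvd : (33 : ℤ) ∣ m * 3 := by
      have h := orderOf_dvd_iff_zpow_eq_one.mpr hcube
      rwa [hord] at h
    have hxm : x ^ m = 1 := by
      rw [← orderOf_dvd_iff_zpow_eq_one, hx]
      push_cast
      omega
    refine ⟨m, ?_⟩
    change σ ^ m = _
    rw [← hm, hc.mul_zpow, hxm, one_mul]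
  refine ⟨fun y hy g => ?_⟩
  obtain ⟨m, rfl⟩ := hy
  change g * σ ^ m * g⁻¹ ∈ _
  rw [← conj_zpow]
  exact Subgroup.zpow_mem _ (hconj g) m

theorem stmt_11 (G : Type) [Group G] (hG : Nat.card G = 66) :
    ¬ ∃ τ σ : G, orderOf τ = 2 ∧ orderOf σ = 3 ∧
      Subgroup.closure ({τ, σ} : Set G) = ⊤ := by
  rintro ⟨τ, σ, hτ, hσ, hcl⟩
  have hN := normal_zpowers_of_orderOf_three G hG hσ
  let π := QuotientGroup.mk' (Subgroup.zpowers σ)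
  have htop : Subgroup.zpowers (π τ) = ⊤ := by
    have hmap : (Subgroup.closure ({τ, σ} : Set G)).map π = ⊤ := by
      rw [hcl]
      exact Subgroup.map_top_of_surjective π (QuotientGroup.mk'_surjective _)
    rw [eq_top_iff, ← hmap, Subgroup.map_le_iff_le_comap, Subgroup.closure_le]
    rintro y (rfl | rfl)
    · exact Subgroup.mem_zpowers (π y)
    · have hy : π y = 1 := (QuotientGroup.eq_one_iff y).mpr (Subgroup.mem_zpowers y)
      change π y ∈ Subgroup.zpowers (π τ)
      rw [hy]
      exact one_mem _
  have hcard : Nat.card (G ⧸ Subgroup.zpowers σ) = 22 := by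
    have h := (Subgroup.zpowers σ).card_mul_index
    rw [hG, Nat.card_zpowers, hσ] at h
    change (Subgroup.zpowers σ).index = 22
    omega
  have hord : orderOf (π τ) = 22 := by
    rw [← Nat.card_zpowers, htop, Subgroup.card_top, hcard]
  have hdvd := orderOf_map_dvd π τ
  rw [hord, hτ] at hdvd
  omega
end

section
/- The projective special linear group PSL₂(𝔽₇) (the quotient of SL₂ over the field with 7 elements by its center) contains elements τ and σ with orderOf τ = 2, orderOf σ = 3, orderOf (τσ) = 7, such that the subgroup generated by {τ, σ} is the whole group; moreover, the order of PSL₂(𝔽₇) is 168. -/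
/-- The projective special linear group `PSL₂(𝔽₇)`: the quotient of
`SL₂(ZMod 7)` by its center. -/
abbrev PSL27 : Type :=
  Matrix.SpecialLinearGroup (Fin 2) (ZMod 7) ⧸
    Subgroup.center (Matrix.SpecialLinearGroup (Fin 2) (ZMod 7))

namespace Matrix.SpecialLinearGroup

theorem card_mul_card_units (n R : Type*) [Fintype n] [DecidableEq n] [Nonempty n] [CommRing R] :
    Nat.card (SpecialLinearGroup n R) * Nat.card Rˣ = Nat.card (GL n R) := by
  have hrange : (toGL : SpecialLinearGroup n R →* GL n R).range =
      (GeneralLinearGroup.det : GL n R →* Rˣ).ker := by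
    ext A
    constructor
    · rintro ⟨B, rfl⟩
      exact Units.ext B.2
    · intro hA
      exact ⟨⟨A, congrArg Units.val hA⟩, Units.ext rfl⟩
  rw [Nat.card_congr (MonoidHom.ofInjective toGL_injective).toEquiv, hrange,
    ← Subgroup.card_mul_index (GeneralLinearGroup.det : GL n R →* Rˣ).ker,
    Subgroup.index_ker, MonoidHom.range_eq_top.mpr GeneralLinearGroup.det_surjective,
    Subgroup.card_top]

/-- The matrix `!![0, -1; 1, 0]` as an element of `SL₂(R)`. -/
def weyl (R : Type*) [CommRing R] : SpecialLinearGroup (Fin 2) R :=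
  ⟨!![0, -1; 1, 0], by simp [det_fin_two]⟩

/-- The matrix `!![1, b; 0, 1]` as an element of `SL₂(R)`. -/
def upperUnipotent {R : Type*} [CommRing R] (b : R) : SpecialLinearGroup (Fin 2) R :=
  ⟨!![1, b; 0, 1], by simp [det_fin_two]⟩

section CommRing

variable {R : Type*} [CommRing R]

@[simp]
theorem coe_weyl : (weyl R : Matrix (Fin 2) (Fin 2) R) = !![0, -1; 1, 0] := rfl

@[simp]
theorem coe_upperUnipotent (b : R) :
    (upperUnipotent b : Matrix (Fin 2) (Fin 2) R) = !![1, b; 0, 1] := rfl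

theorem upperUnipotent_pow (b : R) (k : ℕ) : upperUnipotent b ^ k = upperUnipotent (k * b) := by
  induction k with
  | zero => exact Subtype.ext (by simp [one_fin_two])
  | succ k ih =>
    rw [pow_succ, ih]
    exact Subtype.ext (by simp [add_comm, add_mul])

theorem weyl_sq_mem_center : weyl R ^ 2 ∈ Subgroup.center (SpecialLinearGroup (Fin 2) R) := by
  have h : weyl R ^ 2 = -1 := Subtype.ext (by simp [pow_two, one_fin_two])
  rw [h, Subgroup.mem_center_iff]
  simp

theorem weyl_inv_mul_upperUnipotent_pow_three :
    ((weyl R)⁻¹ * upperUnipotent 1) ^ 3 = 1 :=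
  Subtype.ext (by simp [pow_succ, one_fin_two, adjugate_fin_two])

theorem not_commute_weyl_upperUnipotent [Nontrivial R] :
    ¬ Commute (weyl R) (upperUnipotent 1) := by
  intro h
  simpa using congrArg (fun A : SpecialLinearGroup (Fin 2) R => A.1 0 0) h.eq

end CommRing

theorem closure_weyl_upperUnipotent (p : ℕ) [Fact p.Prime] :
    Subgroup.closure {weyl (ZMod p), upperUnipotent 1} = ⊤ := by
  set H := Subgroup.closure {weyl (ZMod p), upperUnipotent 1}
  have hw : weyl (ZMod p) ∈ H := Subgroup.subset_closure (by simp)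
  have hu (b : ZMod p) : upperUnipotent b ∈ H := by
    have h : upperUnipotent (1 : ZMod p) ∈ H := Subgroup.subset_closure (by simp)
    simpa [upperUnipotent_pow] using H.pow_mem h b.val
  refine (Subgroup.eq_top_iff' H).mpr fun A =>
    SL2.transvection_induction (· ∈ H) (fun i j hij c => ?_) (fun _ _ => H.mul_mem) A
  fin_cases i <;> fin_cases j
  · exact absurd rfl hij
  · convert hu c
    ext i j
    fin_cases i <;> fin_cases j <;> simp [transvection_coe]
  · convert H.mul_mem (H.mul_mem hw (hu (-c))) (H.inv_mem hw)
    ext i j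
    fin_cases i <;> fin_cases j <;>
      simp [transvection_coe, adjugate_fin_two]
  · exact absurd rfl hij

end Matrix.SpecialLinearGroup

theorem QuotientGroup.orderOf_mk_center_eq_prime {G : Type*} [Group G] {p : ℕ} [Fact p.Prime]
    {g h : G} (hg : g ^ p ∈ Subgroup.center G) (hgh : ¬ Commute h g) :
    orderOf (g : G ⧸ Subgroup.center G) = p := by
  refine orderOf_eq_prime ?_ ?_
  · rwa [← QuotientGroup.mk_pow, QuotientGroup.eq_one_iff]
  · rw [Ne, QuotientGroup.eq_one_iff, Subgroup.mem_center_iff]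
    exact fun H => hgh (H h)

open Matrix Matrix.SpecialLinearGroup

instance : Fact (Nat.Prime 7) := ⟨by norm_num⟩

theorem card_SL27 : Nat.card (SpecialLinearGroup (Fin 2) (ZMod 7)) = 336 := by
  have h := card_mul_card_units (Fin 2) (ZMod 7)
  rw [card_GL_field, Nat.card_eq_fintype_card (α := (ZMod 7)ˣ), ZMod.card_units] at h
  norm_num [Fin.prod_univ_two, ZMod.card, -Nat.card_eq_fintype_card] at h
  omega

theorem card_center_SL27 :
    Nat.card (Subgroup.center (SpecialLinearGroup (Fin 2) (ZMod 7))) = 2 := by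
  rw [Nat.card_congr (center_equiv_rootsOfUnity' (0 : Fin 2)).toEquiv, Fintype.card_fin]
  exact (IsPrimitiveRoot.neg_one 7 (by norm_num)).card_rootsOfUnity

theorem card_PSL27 : Nat.card PSL27 = 168 := by
  have h := Subgroup.card_eq_card_quotient_mul_card_subgroup
    (Subgroup.center (SpecialLinearGroup (Fin 2) (ZMod 7)))
  rw [card_SL27, card_center_SL27] at h
  change 336 = Nat.card PSL27 * 2 at h
  omega

theorem stmt_12 :
    (∃ τ σ : PSL27, orderOf τ = 2 ∧ orderOf σ = 3 ∧ orderOf (τ * σ) = 7 ∧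
      Subgroup.closure ({τ, σ} : Set PSL27) = ⊤) ∧
    Nat.card PSL27 = 168 := by
  refine ⟨?_, card_PSL27⟩
  let π := QuotientGroup.mk' (Subgroup.center (SpecialLinearGroup (Fin 2) (ZMod 7)))
  let S := weyl (ZMod 7)
  let T := upperUnipotent (1 : ZMod 7)
  have hST : ¬ Commute S T := not_commute_weyl_upperUnipotent
  have hT : T ^ 7 = 1 := by decide
  have hprod : π S * π (S⁻¹ * T) = π T := by rw [← map_mul, mul_inv_cancel_left]
  refine ⟨π S, π (S⁻¹ * T), ?_, ?_, ?_, ?_⟩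
  · exact QuotientGroup.orderOf_mk_center_eq_prime weyl_sq_mem_center fun h => hST h.symm
  · refine QuotientGroup.orderOf_mk_center_eq_prime (h := S) ?_ fun h => hST ?_
    · rw [weyl_inv_mul_upperUnipotent_pow_three]
      exact Subgroup.one_mem _
    · simpa using (Commute.refl S).mul_right h
  · rw [hprod]
    refine QuotientGroup.orderOf_mk_center_eq_prime ?_ hST
    rw [hT]
    exact Subgroup.one_mem _
  · set K := Subgroup.closure {π S, π (S⁻¹ * T)}
    have hS : π S ∈ K := Subgroup.subset_closure (by simp)
    have hσ : π (S⁻¹ * T) ∈ K := Subgroup.subset_closure (by simp)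
    have hle : Subgroup.closure {S, T} ≤ K.comap π := by
      rw [Subgroup.closure_le, Set.pair_subset_iff]
      exact ⟨hS, show π T ∈ K from hprod ▸ K.mul_mem hS hσ⟩
    rw [closure_weyl_upperUnipotent, top_le_iff] at hle
    rw [← Subgroup.map_comap_eq_self_of_surjective (QuotientGroup.mk'_surjective _) K, hle,
      Subgroup.map_top_of_surjective _ (QuotientGroup.mk'_surjective _)]
end
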